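/- Let (L,H) be a cover of a finite simple graph G and let S ⊆ V(H). Define W := {x ∈ S : N_H(x) ∩ S = ∅}, A := {v ∈ V(G) : L(v) ∩ S ≠ ∅ and L(v) ∩ S ⊆ W}, let G' := G − A (the induced subgraph on V(G) \ A), and let (L',H') be the induced cover of G' (L'(v) = L(v) for v ∈ V(G'), H' the subgraph of H induced by ⋃_{v∈V(G')} L(v)). Suppose I' is an (L',H')-coloring of G' such that no vertex of I' is adjacent in H to a vertex of S. Then I := I' ∪ ⋃_{v∈A} (L(v) ∩ S) is an (L,H)-coloring of G. -/

import Mathlib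

open Classical Finset Real

/-- A cover `(L, H)` of a graph `G`. Colors form a type `W`; `toFun` sends each color to the
vertex it belongs to, so that the list of `v` is `L v = toFun ⁻¹' {v}` (the lists are then
automatically pairwise disjoint). `graph` is the cover graph `H`. -/
structure Cover {V : Type*} (G : SimpleGraph V) (W : Type*) where
  toFun : W → V
  graph : SimpleGraph W
  adj_map : ∀ ⦃x y : W⦄, graph.Adj x y → G.Adj (toFun x) (toFun y)
  matching : ∀ ⦃x y y' : W⦄, graph.Adj x y → graph.Adj x y' → toFun y = toFun y' → y = y'

namespace Cover

variable {V W : Type*} {G : SimpleGraph V}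

/-- `I` is an `(L,H)`-coloring of `G`: an independent set of `H` meeting every list. -/
def IsColoring (C : Cover G W) (I : Set W) : Prop :=
  (∀ ⦃x⦄, x ∈ I → ∀ ⦃y⦄, y ∈ I → ¬ C.graph.Adj x y) ∧ ∀ v : V, ∃ x ∈ I, C.toFun x = v

/-- `G` is `(L,H)`-colorable. -/
def Colorable (C : Cover G W) : Prop := ∃ I : Set W, C.IsColoring I

end Cover

/-- `G` is `k`-correspondence-colorable. -/
def CorrColorable {V : Type} [Fintype V] (G : SimpleGraph V) (k : ℕ) : Prop :=
  ∀ (W : Type) [Fintype W] (C : Cover G W),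
    (∀ v : V, k ≤ Fintype.card {x : W // C.toFun x = v}) → C.Colorable

/-- The correspondence chromatic number `χ_c(G)`. -/
noncomputable def corrChromaticNumber {V : Type} [Fintype V] (G : SimpleGraph V) : ℕ :=
  sInf {k : ℕ | CorrColorable G k}

namespace Cover

variable {V W : Type*} {G : SimpleGraph V}

/-- `I` is a coloring of the subgraph of `G` induced by `A`, with respect to the induced
cover: `I` uses only colors lying over `A`, is independent in `H`, and meets the list of
every vertex of `A`. -/
def IsColoringOn (C : Cover G W) (A : Set V) (I : Set W) : Prop :=
  (∀ x ∈ I, C.toFun x ∈ A) ∧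
    (∀ ⦃x⦄, x ∈ I → ∀ ⦃y⦄, y ∈ I → ¬ C.graph.Adj x y) ∧
    ∀ v ∈ A, ∃ x ∈ I, C.toFun x = v

end Cover

/-- **Correctness of the deletion step.** Let `(L,H)` be a cover of `G` and `S ⊆ V(H)`.
Put `W₀ := {x ∈ S : N_H(x) ∩ S = ∅}` and
`A := {v : L(v) ∩ S ≠ ∅ and L(v) ∩ S ⊆ W₀}`, and let `G' := G − A` with its induced
cover. If `I'` is an `(L',H')`-coloring of `G'` no vertex of which is `H`-adjacent to a
vertex of `S`, then `I' ∪ ⋃_{v ∈ A} (L(v) ∩ S)` is an `(L,H)`-coloring of `G`. -/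
theorem coloring_of_deletion
    {V W : Type} {G : SimpleGraph V} (C : Cover G W) (S : Set W)
    (W₀ : Set W) (hW₀ : W₀ = {x ∈ S | ∀ y : W, C.graph.Adj x y → y ∉ S})
    (A : Set V)
    (hA : A = {v : V | (∃ x : W, C.toFun x = v ∧ x ∈ S) ∧
      ∀ x : W, C.toFun x = v → x ∈ S → x ∈ W₀})
    (I' : Set W) (hI' : C.IsColoringOn Aᶜ I')
    (hadj : ∀ x ∈ I', ∀ y ∈ S, ¬ C.graph.Adj x y) :
    C.IsColoring (I' ∪ {x : W | x ∈ S ∧ C.toFun x ∈ A}) := by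
  subst hW₀ hA
  obtain ⟨-, hind, hmeet⟩ := hI'
  refine ⟨?_, fun v => ?_⟩
  · rintro x (hx | ⟨hxS, hxA⟩) y (hy | ⟨hyS, -⟩) hxy
    · exact hind hx hy hxy
    · exact hadj x hx y hyS hxy
    · exact hadj y hy x hxS hxy.symm
    · exact (hxA.2 x rfl hxS).2 y hxy hyS
  · by_cases hv : v ∈ {v : V | (∃ x : W, C.toFun x = v ∧ x ∈ S) ∧
        ∀ x : W, C.toFun x = v → x ∈ S → x ∈ {x ∈ S | ∀ y : W, C.graph.Adj x y → y ∉ S}}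
    · obtain ⟨x, rfl, hxS⟩ := hv.1
      exact ⟨x, Or.inr ⟨hxS, hv⟩, rfl⟩
    · obtain ⟨x, hx, hxv⟩ := hmeet v hv
      exact ⟨x, Or.inl hx, hxv⟩
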